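/- arXiv:1701.05989 — 2 statements merged into one kernel-verified Lean document; each statement's English description precedes it below -/
import Mathlib

section
/- Let C be a k-dimensional linear subspace of 𝔽₂ⁿ whose nonzero vectors all have Hamming weight at least d, having locality r, with d ≥ 5 and 2 ≤ r ≤ n/2 − 2. Then, as real numbers, k ≤ rn/(r+1) − min{ log₂(1 + rn/2), rn/((r+1)(r+2)) }. -/
lemma lrc_poly (m v : ℝ) (hm : 4 ≤ m) (hv : 0 ≤ v) (hvm : v ≤ m - 2) :
    2 * m * (m + v) ^ 2 * v * (v + 1) + (m + v) ^ 3 ≤ m * (m + 2 * m * v + v ^ 2) ^ 2 := by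
  have hb : 0 ≤ m^3*(2*v+2) - m^2*(2*v+3) - m*(v^3+2*v^2+3*v) - v^2 := by
    have e1 : v^2 ≤ (m-2)*v := by nlinarith
    have e2 : v^3 ≤ (m-2)^2*v := by
      have : v^2 ≤ (m-2)^2 := by nlinarith
      nlinarith
    have e3 : m * v^3 ≤ m * ((m-2)^2*v) := by gcongr
    have e4 : m * v^2 ≤ m * ((m-2)*v) := by gcongr
    have e5 : 0 ≤ v * (m^3 - 4*m + 2) := by
      apply mul_nonneg hv
      nlinarith [mul_nonneg (by linarith : 0 ≤ m) (by nlinarith : 0 ≤ m^2 - 4)]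
    have e6 : 0 ≤ m^2 * (2*m - 3) := by
      apply mul_nonneg (by positivity); linarith
    nlinarith
  nlinarith [mul_nonneg hv hb]

lemma lrc_second (n s x : ℝ) (hs : 3 ≤ s) (hn : 2 * (s + 1) ≤ n) (hx : 0 < x)
    (h1 : n ≤ s * x) (h2 : (s + 1) * x ≤ 2 * n) :
    0 ≤ (2 * n ^ 2 / x - n * (2 * s + 1) + s * (s + 1) * x / 2) ∧
    (1 + (2 * n ^ 2 / x - n * (2 * s + 1) + s * (s + 1) * x / 2)) * (4 * n ^ 2 / x ^ 3)
      ≤ (-(2 * n ^ 2) / x ^ 2 + s * (s + 1) / 2) ^ 2 := by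
  obtain ⟨v, hv⟩ : ∃ v, n = (s + 1 + v) * x / 2 := ⟨2 * n / x - s - 1, by field_simp; ring⟩
  have hv0 : 0 ≤ v := by
    by_contra h; push Not at h
    nlinarith
  have hv1 : v ≤ s + 1 - 2 := by
    by_contra h; push Not at h
    nlinarith
  have hp := lrc_poly (s + 1) v (by linarith) hv0 hv1
  have eP : 2 * n ^ 2 / x - n * (2 * s + 1) + s * (s + 1) * x / 2 = x / 2 * (v + 1) * v := by
    rw [hv]; field_simp; ring
  have eP1 : -(2 * n ^ 2) / x ^ 2 + s * (s + 1) / 2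
      = -((s + 1) + 2 * (s + 1) * v + v ^ 2) / 2 := by
    rw [hv]; field_simp; ring
  have eP2 : 4 * n ^ 2 / x ^ 3 = (s + 1 + v) ^ 2 / x := by
    rw [hv]; field_simp; ring
  rw [eP, eP1, eP2]
  refine ⟨by positivity, ?_⟩
  have e : (1 + x / 2 * (v + 1) * v) * ((s + 1 + v) ^ 2 / x)
      = (s + 1 + v) ^ 2 / x + (s + 1 + v) ^ 2 * (v + 1) * v / 2 := by field_simp
  have e' : (s + 1 + v) ^ 2 / x ≤ (s + 1 + v) ^ 3 / (4 * (s + 1)) := by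
    rw [div_le_div_iff₀ hx (by positivity)]
    have : 4 * (s + 1) ≤ (s + 1 + v) * x := by linarith
    calc (s + 1 + v) ^ 2 * (4 * (s + 1)) ≤ (s + 1 + v) ^ 2 * ((s + 1 + v) * x) := by gcongr
      _ = _ := by ring
  rw [e]
  refine (add_le_add_left e' _).trans ?_
  have hs1 : 0 < s + 1 := by linarith
  rw [← sub_nonneg]
  have : (-((s + 1) + 2 * (s + 1) * v + v ^ 2) / 2) ^ 2 - ((s + 1 + v) ^ 3 / (4 * (s + 1)) +
      (s + 1 + v) ^ 2 * (v + 1) * v / 2) = ((s+1) * ((s+1) + 2 * (s+1) * v + v ^ 2) ^ 2 -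
      (2 * (s+1) * ((s+1) + v) ^ 2 * v * (v + 1) + ((s+1) + v) ^ 3)) / (4 * (s+1)) := by
    field_simp; ring
  rw [this]
  exact div_nonneg (by linarith) (by positivity)

lemma lrc_num (n s l : ℝ) (hs : 3 ≤ s) (hn : 2 * (s + 1) ≤ n)
    (h1 : n / s ≤ l) (h2 : l ≤ 2 * n / (s + 1)) :
    min (n / s + Real.logb 2 (1 + (s - 1) * n / 2)) (2 * n / (s + 1)) ≤
      l + Real.logb 2 (1 + (2 * n ^ 2 / l - n * (2 * s + 1) + s * (s + 1) * l / 2)) := by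
  have hs0 : 0 < s := by linarith
  have hn0 : 0 < n := by linarith
  have hL : 0 < Real.log 2 := Real.log_pos (by norm_num)
  set f : ℝ → ℝ := fun x => x +
    Real.log (1 + (2 * n ^ 2 / x - n * (2 * s + 1) + s * (s + 1) * x / 2)) / Real.log 2 with hf
  have key : ∀ x ∈ Set.Icc (n / s) (2 * n / (s + 1)), 0 < x ∧
      0 ≤ (2 * n ^ 2 / x - n * (2 * s + 1) + s * (s + 1) * x / 2) ∧
      (1 + (2 * n ^ 2 / x - n * (2 * s + 1) + s * (s + 1) * x / 2)) * (4 * n ^ 2 / x ^ 3)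
      ≤ (-(2 * n ^ 2) / x ^ 2 + s * (s + 1) / 2) ^ 2 := by
    intro x hx
    have hx0 : 0 < x := lt_of_lt_of_le (by positivity) hx.1
    refine ⟨hx0, lrc_second n s x hs hn hx0 ?_ ?_⟩
    · have := (div_le_iff₀ hs0).1 hx.1; linarith
    · have := (le_div_iff₀ (by linarith)).1 hx.2; linarith
  have d1 : ∀ x : ℝ, 0 < x → HasDerivAt
      (fun x : ℝ => 1 + (2 * n ^ 2 / x - n * (2 * s + 1) + s * (s + 1) * x / 2))
      (-(2 * n ^ 2) / x ^ 2 + s * (s + 1) / 2) x := by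
    intro x hx
    have a := ((hasDerivAt_inv hx.ne').const_mul (2 * n ^ 2))
    have b := (hasDerivAt_id x).const_mul (s * (s + 1) / 2)
    have c := ((a.sub_const (n * (2 * s + 1))).add b).const_add 1
    refine (c.congr_deriv ?_).congr_of_eventuallyEq ?_
    · field_simp
    · refine Filter.Eventually.of_forall fun y => ?_
      simp [div_eq_mul_inv]; ring
  have d2 : ∀ x : ℝ, 0 < x → HasDerivAt
      (fun x : ℝ => (-(2 * n ^ 2) / x ^ 2 + s * (s + 1) / 2)) (4 * n ^ 2 / x ^ 3) x := by
    intro x hx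
    have a := ((((hasDerivAt_pow 2 x).inv (by positivity)).const_mul (-(2 * n ^ 2)))).add_const
      (s * (s + 1) / 2)
    refine (a.congr_deriv ?_).congr_of_eventuallyEq ?_
    · field_simp; ring
    · refine Filter.Eventually.of_forall fun y => ?_
      simp [div_eq_mul_inv]
  have hc : ConcaveOn ℝ (Set.Icc (n / s) (2 * n / (s + 1))) f := by
    refine concaveOn_of_hasDerivWithinAt2_nonpos (convex_Icc _ _)
      (f' := fun x => 1 + (-(2 * n ^ 2) / x ^ 2 + s * (s + 1) / 2) /
        (1 + (2 * n ^ 2 / x - n * (2 * s + 1) + s * (s + 1) * x / 2)) / Real.log 2)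
      (f'' := fun x => (((4 * n ^ 2 / x ^ 3) *
        (1 + (2 * n ^ 2 / x - n * (2 * s + 1) + s * (s + 1) * x / 2)) -
        (-(2 * n ^ 2) / x ^ 2 + s * (s + 1) / 2) * (-(2 * n ^ 2) / x ^ 2 + s * (s + 1) / 2)) /
        (1 + (2 * n ^ 2 / x - n * (2 * s + 1) + s * (s + 1) * x / 2)) ^ 2) / Real.log 2)
      ?_ ?_ ?_ ?_
    · intro x hx
      obtain ⟨k1, k2, k3⟩ := key x hx
      exact ((hasDerivAt_id x).add (((d1 x k1).log (by positivity)).div_const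
        _)).continuousAt.continuousWithinAt
    · intro x hx
      obtain ⟨k1, k2, k3⟩ := key x (interior_subset hx)
      exact ((hasDerivAt_id x).add (((d1 x k1).log (by positivity)).div_const
        _)).hasDerivWithinAt
    · intro x hx
      obtain ⟨k1, k2, k3⟩ := key x (interior_subset hx)
      exact ((((d2 x k1).div (d1 x k1) (by positivity)).div_const
        _).const_add 1).hasDerivWithinAt
    · intro x hx
      obtain ⟨k1, k2, k3⟩ := key x (interior_subset hx)
      apply div_nonpos_of_nonpos_of_nonneg _ hL.le
      apply div_nonpos_of_nonpos_of_nonneg _ (by positivity)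
      nlinarith
  have hab : n / s ≤ 2 * n / (s + 1) := h1.trans h2
  have := hc.min_le_of_mem_Icc (Set.left_mem_Icc.2 hab) (Set.right_mem_Icc.2 hab) ⟨h1, h2⟩
  have ea : f (n / s) = n / s + Real.logb 2 (1 + (s - 1) * n / 2) := by
    simp only [hf, Real.logb]
    congr 4
    field_simp; ring
  have eb : f (2 * n / (s + 1)) = 2 * n / (s + 1) := by
    simp only [hf]
    have : 1 + (2 * n ^ 2 / (2 * n / (s + 1)) - n * (2 * s + 1) +
      s * (s + 1) * (2 * n / (s + 1)) / 2) = 1 := by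
      field_simp; ring
    rw [this]; simp
  rw [ea, eb] at this
  exact this

open Finset in
lemma lrc_count {n l : ℕ} (r : ℕ) (h : Fin l → Fin n → ZMod 2)
    (hw : ∀ j, hammingNorm (h j) ≤ r + 1) (hcov : ∀ i, ∃ j, h j i ≠ 0) :
    n ≤ l * (r + 1) ∧
    2 * n ≤ l * (r + 1) +
      ∑ j, (univ.filter fun i => h j i ≠ 0 ∧ ∀ j', j' ≠ j → h j' i = 0).card := by
  have hs : ∑ i : Fin n, (univ.filter fun j => h j i ≠ 0).card ≤ l * (r + 1) := by
    have : ∑ i : Fin n, (univ.filter fun j => h j i ≠ 0).card = ∑ j, hammingNorm (h j) := by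
      simp only [hammingNorm, card_filter]
      exact sum_comm
    rw [this]
    refine (sum_le_card_nsmul _ _ (r + 1) fun j _ => hw j).trans ?_
    simp
  constructor
  · refine le_trans ?_ hs
    have := card_nsmul_le_sum univ (fun i : Fin n => (univ.filter fun j => h j i ≠ 0).card) 1 ?_
    · simpa using this
    · intro i _
      obtain ⟨j, hj⟩ := hcov i
      exact card_pos.2 ⟨j, by simp [hj]⟩
  · refine le_trans ?_ (Nat.add_le_add_right hs _)
    have e : ∑ j, (univ.filter fun i => h j i ≠ 0 ∧ ∀ j', j' ≠ j → h j' i = 0).card =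
      ∑ i : Fin n, (univ.filter fun j => h j i ≠ 0 ∧ ∀ j', j' ≠ j → h j' i = 0).card := by
      simp only [card_filter]
      exact sum_comm
    rw [e, ← sum_add_distrib]
    have := card_nsmul_le_sum univ (fun i : Fin n => (univ.filter fun j => h j i ≠ 0).card +
      (univ.filter fun j => h j i ≠ 0 ∧ ∀ j', j' ≠ j → h j' i = 0).card) 2 ?_
    · simp only [card_univ, Fintype.card_fin, smul_eq_mul] at this
      linarith
    · intro i _
      obtain ⟨j, hj⟩ := hcov i
      by_cases hu : ∀ j', j' ≠ j → h j' i = 0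
      · have a : 0 < (univ.filter fun j => h j i ≠ 0).card := card_pos.2 ⟨j, by simp [hj]⟩
        have b : 0 < (univ.filter fun j => h j i ≠ 0 ∧ ∀ j', j' ≠ j → h j' i = 0).card :=
          card_pos.2 ⟨j, mem_filter.2 ⟨mem_univ _, hj, hu⟩⟩
        omega
      · push Not at hu
        obtain ⟨j', hne, hj'⟩ := hu
        have : 1 < (univ.filter fun j => h j i ≠ 0).card :=
          one_lt_card.2 ⟨j, by simp [hj], j', by simp [hj'], hne.symm⟩
        omega

open Finset in
lemma lrc_ball {n l : ℕ} (h : Fin l → Fin n → ZMod 2) :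
    1 + ∑ j, (univ.filter fun i => h j i ≠ 0 ∧ ∀ j', j' ≠ j → h j' i = 0).card.choose 2 ≤
    (univ.filter fun v : Fin n → ZMod 2 =>
      (∀ j, ∑ i, h j i * v i = 0) ∧ hammingNorm v ≤ 2).card := by
  classical
  set A : Fin l → Finset (Fin n) :=
    fun j => univ.filter fun i => h j i ≠ 0 ∧ ∀ j', j' ≠ j → h j' i = 0 with hA
  set U : Finset (Finset (Fin n)) := univ.biUnion fun j => powersetCard 2 (A j) with hU
  let ind : Finset (Fin n) → Fin n → ZMod 2 := fun T i => if i ∈ T then 1 else 0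
  have hinj : Function.Injective ind := by
    intro S T hST
    ext i
    have := congrFun hST i
    by_cases h1 : i ∈ S <;> by_cases h2 : i ∈ T <;> simp [ind, h1, h2] at this ⊢
  have hUc : U.card = ∑ j, (A j).card.choose 2 := by
    rw [hU, card_biUnion]
    · simp
    · intro j _ j' _ hne
      rw [Function.onFun, disjoint_left]
      intro T hT hT'
      rw [mem_powersetCard] at hT hT'
      obtain ⟨x, hx⟩ : T.Nonempty := card_pos.1 (by omega)
      have h1 := hT.1 hx
      have h2 := hT'.1 hx
      simp only [hA, mem_filter] at h1 h2
      exact h2.2.1 (h1.2.2 j' hne.symm)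
  have h0 : ind ∅ = 0 := by ext i; simp [ind]
  have hemp : ∅ ∉ U := by
    simp [hU, mem_powersetCard]
  have : (insert ∅ U).card = 1 + ∑ j, (A j).card.choose 2 := by
    rw [card_insert_of_notMem hemp, hUc, add_comm]
  rw [← this, ← card_image_of_injective _ hinj]
  apply card_le_card
  intro v hv
  rw [mem_image] at hv
  obtain ⟨T, hT, rfl⟩ := hv
  rw [mem_filter]
  refine ⟨mem_univ _, ?_⟩
  rw [mem_insert] at hT
  rcases hT with rfl | hT
  · rw [h0]; simp
  · simp only [hU, mem_biUnion, mem_powersetCard] at hT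
    obtain ⟨j, -, hTA, hTc⟩ := hT
    constructor
    · intro j'
      have e : ∑ i, h j' i * ind T i = ∑ i ∈ T, h j' i := by
        simp [ind]
      rw [e]
      by_cases hjj : j' = j
      · subst hjj
        have : ∀ i ∈ T, h j' i = 1 := by
          intro i hi
          have := hTA hi
          simp only [hA, mem_filter] at this
          have h3 := this.2.1
          revert h3
          generalize h j' i = z
          revert z
          decide
        rw [sum_congr rfl this]
        simp [hTc]
        decide
      · apply sum_eq_zero
        intro i hi
        have := hTA hi
        simp only [hA, mem_filter] at this
        exact this.2.2 j' hjj
    · simp only [hammingNorm]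
      refine le_trans (card_le_card ?_) hTc.le
      intro i hi
      simpa [ind] using hi

open Finset in
lemma lrc_pack {n l : ℕ} (h : Fin l → Fin n → ZMod 2) (hli : LinearIndependent (ZMod 2) h)
    (C : Submodule (ZMod 2) (Fin n → ZMod 2)) (hC : ∀ c ∈ C, ∀ j, ∑ i, h j i * c i = 0)
    (hdist : ∀ c ∈ C, c ≠ 0 → 5 ≤ hammingNorm c) :
    2 ^ Module.finrank (ZMod 2) C * 2 ^ l * (univ.filter fun v : Fin n → ZMod 2 =>
      (∀ j, ∑ i, h j i * v i = 0) ∧ hammingNorm v ≤ 2).card ≤ 2 ^ n := by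
  classical
  set B := univ.filter fun v : Fin n → ZMod 2 =>
      (∀ j, ∑ i, h j i * v i = 0) ∧ hammingNorm v ≤ 2 with hB
  set V := LinearMap.ker (Matrix.mulVecLin (Matrix.of h)) with hV
  have memV : ∀ v, v ∈ V ↔ ∀ j, ∑ i, h j i * v i = 0 := by
    intro v
    rw [hV, LinearMap.mem_ker, Matrix.mulVecLin_apply, funext_iff]
    rfl
  have hVf : l + Module.finrank (ZMod 2) V = n := by
    have h1 := LinearMap.finrank_range_add_finrank_ker (Matrix.mulVecLin (Matrix.of h))
    have h2 : (Matrix.of h).rank = l := by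
      have := LinearIndependent.rank_matrix (M := Matrix.of h) hli
      simpa using this
    rw [Matrix.rank] at h2
    rw [h2] at h1
    simpa using h1
  have cV : Fintype.card V = 2 ^ Module.finrank (ZMod 2) V := by
    rw [Module.card_eq_pow_finrank (K := ZMod 2), ZMod.card]
  have cC : Fintype.card C = 2 ^ Module.finrank (ZMod 2) C := by
    rw [Module.card_eq_pow_finrank (K := ZMod 2), ZMod.card]
  have hle : Fintype.card (C × B) ≤ Fintype.card V := by
    let g : C × B → V := fun p => ⟨p.1.1 + p.2.1, V.add_mem ((memV _).2 (hC _ p.1.2))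
      ((memV _).2 (mem_filter.1 p.2.2).2.1)⟩
    apply Fintype.card_le_of_injective g
    rintro ⟨⟨c, hc⟩, ⟨b, hb⟩⟩ ⟨⟨c', hc'⟩, ⟨b', hb'⟩⟩ heq
    have heq : c + b = c' + b' := congrArg Subtype.val heq
    rw [hB, mem_filter] at hb hb'
    have hcc : c - c' = b' - b := by
      rw [sub_eq_sub_iff_add_eq_add, heq, add_comm]
    have hw : hammingNorm (c - c') ≤ 4 := by
      have := hammingDist_triangle b 0 b'
      rw [hammingDist_zero_right, hammingDist_zero_left, hammingDist_eq_hammingNorm, neg_add_eq_sub] at this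
      rw [hcc]
      omega
    have h0 : c - c' = 0 := by
      by_contra hne
      have := hdist _ (C.sub_mem hc hc') hne
      omega
    have h1 : c = c' := sub_eq_zero.1 h0
    subst h1
    have h2 : b = b' := add_left_cancel heq
    subst h2
    rfl
  rw [Fintype.card_prod, cC, cV, Fintype.card_coe] at hle
  calc _ = 2 ^ l * (2 ^ Module.finrank (ZMod 2) C * B.card) := by ring
    _ ≤ 2 ^ l * 2 ^ Module.finrank (ZMod 2) V := by gcongr
    _ = _ := by rw [← pow_add, hVf]

lemma lrc_basis {n r : ℕ} (C : Submodule (ZMod 2) (Fin n → ZMod 2))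
    (hloc : ∀ i : Fin n, ∃ h : Fin n → ZMod 2,
      (∀ c ∈ C, ∑ i', h i' * c i' = 0) ∧ h i ≠ 0 ∧ hammingNorm h ≤ r + 1) :
    ∃ (l : ℕ) (h : Fin l → Fin n → ZMod 2), LinearIndependent (ZMod 2) h ∧
      (∀ c ∈ C, ∀ j, ∑ i, h j i * c i = 0) ∧ (∀ j, hammingNorm (h j) ≤ r + 1) ∧
      ∀ i, ∃ j, h j i ≠ 0 := by
  let S : Set (Fin n → ZMod 2) :=
    {h | (∀ c ∈ C, ∑ i', h i' * c i' = 0) ∧ hammingNorm h ≤ r + 1}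
  obtain ⟨f, hfS, hsp, hli⟩ := Submodule.exists_fun_fin_finrank_span_eq (ZMod 2) S
  refine ⟨_, f, hli, fun c hc j => (hfS j).1 c hc, fun j => (hfS j).2, fun i => ?_⟩
  by_contra hno
  push Not at hno
  obtain ⟨g, hg1, hg2, hg3⟩ := hloc i
  have hg : g ∈ Submodule.span (ZMod 2) (Set.range f) := by
    rw [hsp]; exact Submodule.subset_span ⟨hg1, hg3⟩
  have hle : Submodule.span (ZMod 2) (Set.range f) ≤
      LinearMap.ker (LinearMap.proj (R := ZMod 2) (φ := fun _ : Fin n => ZMod 2) i) := by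
    rw [Submodule.span_le]
    rintro _ ⟨j, rfl⟩
    exact hno j
  exact hg2 (hle hg)



/-- Theorem 3 of the paper: for any `[n,k,d]` binary linear LRC with locality `r`,
`d ≥ 5` and `2 ≤ r ≤ n/2 − 2`, it holds
`k ≤ rn/(r+1) − min{ log₂(1 + rn/2), rn/((r+1)(r+2)) }`. -/
theorem stmt_7 (n k d r : ℕ)
    (C : Submodule (ZMod 2) (Fin n → ZMod 2))
    (hk : Module.finrank (ZMod 2) C = k)
    (hdist : ∀ c ∈ C, c ≠ 0 → d ≤ hammingNorm c)
    (hloc : ∀ i : Fin n, ∃ h : Fin n → ZMod 2,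
      (∀ c ∈ C, ∑ i', h i' * c i' = 0) ∧ h i ≠ 0 ∧ hammingNorm h ≤ r + 1)
    (hd : 5 ≤ d) (hr : 2 ≤ r) (hrn : (r : ℝ) ≤ (n : ℝ) / 2 - 2) :
    (k : ℝ) ≤ (r : ℝ) * n / (r + 1) -
      min (Real.logb 2 (1 + (r : ℝ) * n / 2)) ((r : ℝ) * n / ((r + 1) * (r + 2))) := by
  subst hk
  have hn : 2 * (((r : ℝ) + 1) + 1) ≤ n := by linarith
  have hr' : (2 : ℝ) ≤ r := by exact_mod_cast hr
  have hr0 : (0 : ℝ) < r := by linarith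
  have hn0 : (0 : ℝ) < n := by linarith
  obtain ⟨l, h, hli, hC, hw, hcov⟩ := lrc_basis C hloc
  obtain ⟨hc1, hc2⟩ := lrc_count r h hw hcov
  have hb := lrc_ball h
  have hp := lrc_pack h hli C hC (fun c hc h0 => hd.trans (hdist c hc h0))
  have hp := (Nat.mul_le_mul_left _ hb).trans hp
  set A : Fin l → ℕ := fun j =>
    (Finset.univ.filter fun i => h j i ≠ 0 ∧ ∀ j', j' ≠ j → h j' i = 0).card with hA
  set k := Module.finrank (ZMod 2) C
  have e1 : (r : ℝ) * n / (r + 1) = n - n / (r + 1) := by field_simp; ring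
  have e2 : (r : ℝ) * n / ((r + 1) * (r + 2)) = 2 * n / (r + 1 + 1) - n / (r + 1) := by
    field_simp; ring
  have c1 : (n : ℝ) ≤ l * (r + 1) := by exact_mod_cast hc1
  have c2 : (2 : ℝ) * n ≤ l * (r + 1) + ∑ j, (A j : ℝ) := by exact_mod_cast hc2
  have hl0 : (0 : ℝ) < l := by
    by_contra hneg
    push Not at hneg
    nlinarith
  have c3 : (2 : ℝ) ^ k * 2 ^ l * (1 + ∑ j, (A j : ℝ) * (A j - 1) / 2) ≤ 2 ^ n := by
    simp only [← Nat.cast_choose_two]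
    exact_mod_cast hp
  have hsum0 : 0 ≤ ∑ j, (A j : ℝ) * (A j - 1) / 2 := by
    simp only [← Nat.cast_choose_two]
    positivity
  have c4 : ∀ y : ℝ, 0 ≤ y → y ≤ ∑ j, (A j : ℝ) * (A j - 1) / 2 →
      (k : ℝ) + l + Real.logb 2 (1 + y) ≤ n := by
    intro y hy0 hy
    have q : (2 : ℝ) ^ k * 2 ^ l * (1 + y) ≤ 2 ^ n := by
      refine le_trans ?_ c3
      gcongr
    have q2 := Real.logb_le_logb_of_le (b := 2) (by norm_num) (by positivity) q
    rw [Real.logb_mul (by positivity) (by positivity), Real.logb_mul (by positivity)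
      (by positivity), Real.logb_pow, Real.logb_pow, Real.logb_pow,
      Real.logb_self_eq_one (by norm_num)] at q2
    linarith
  rcases le_total (l : ℝ) (2 * n / (r + 1 + 1)) with hl | hl
  · have h1 : (n : ℝ) / (r + 1) ≤ l := by
      rw [div_le_iff₀ (by positivity)]; exact c1
    have hnum := lrc_num n (r + 1) l (by linarith) hn h1 hl
    have hl' := (le_div_iff₀ (by positivity)).1 hl
    have hsec := (lrc_second n (r + 1) l (by linarith) hn hl0 (by linarith) (by linarith)).1
    have hy : 2 * (n : ℝ) ^ 2 / l - n * (2 * ((r : ℝ) + 1) + 1) +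
        ((r : ℝ) + 1) * ((r : ℝ) + 1 + 1) * l / 2 ≤ ∑ j, (A j : ℝ) * (A j - 1) / 2 := by
      obtain ⟨x, hx⟩ : ∃ x : ℝ, x = 2 * n / l - (r + 1) := ⟨_, rfl⟩
      have hxl : x * l = 2 * n - (r + 1) * l := by rw [hx]; field_simp
      have hx1 : 1 ≤ x := by
        by_contra hneg
        push Not at hneg
        nlinarith
      have t : ∑ j, ((2 * x - 1) * ((A j : ℝ) - x) + x * (x - 1)) / 2 ≤
          ∑ j, (A j : ℝ) * (A j - 1) / 2 := by
        apply Finset.sum_le_sum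
        intro j _
        nlinarith [sq_nonneg ((A j : ℝ) - x)]
      refine le_trans ?_ t
      have t2 : ∑ j, ((2 * x - 1) * ((A j : ℝ) - x) + x * (x - 1)) / 2 =
          ((2 * x - 1) * (∑ j, (A j : ℝ) - l * x) + l * (x * (x - 1))) / 2 := by
        rw [← Finset.sum_div, Finset.sum_add_distrib, ← Finset.mul_sum, Finset.sum_sub_distrib]
        simp
      rw [t2]
      have t3 : 2 * (n : ℝ) ^ 2 / l - n * (2 * ((r : ℝ) + 1) + 1) +
        ((r : ℝ) + 1) * ((r : ℝ) + 1 + 1) * l / 2 = l * (x * (x - 1)) / 2 := by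
        rw [hx]; field_simp; ring
      rw [t3]
      have : 0 ≤ (2 * x - 1) * (∑ j, (A j : ℝ) - l * x) :=
        mul_nonneg (by linarith) (by linarith)
      linarith
    have hk := c4 _ hsec hy
    have e3 : ((r : ℝ) + 1 - 1) * n / 2 = r * n / 2 := by ring
    rw [e3] at hnum
    rw [e1, e2]
    rcases min_le_iff.1 hnum with q | q
    · have := min_le_left (Real.logb 2 (1 + (r : ℝ) * n / 2))
        (2 * n / ((r : ℝ) + 1 + 1) - n / (r + 1))
      linarith
    · have := min_le_right (Real.logb 2 (1 + (r : ℝ) * n / 2))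
        (2 * n / ((r : ℝ) + 1 + 1) - n / (r + 1))
      linarith
  · have hk := c4 0 le_rfl hsum0
    simp only [add_zero, Real.logb_one] at hk
    rw [e1, e2]
    have := min_le_right (Real.logb 2 (1 + (r : ℝ) * n / 2))
      (2 * n / ((r : ℝ) + 1 + 1) - n / (r + 1))
    linarith
end

section
/- Let n and r be real numbers with r ≥ 2 and n ≥ 2(r+2) (i.e., r ≤ n/2 − 2). Define f(l) = l + log₂( 1 + (2n − l(r+1))(2n − l(r+2))/(2l) ) for real l ∈ [n/(r+1), 2n/(r+2)]. Then 1 + (2n − l(r+1))(2n − l(r+2))/(2l) ≥ 1 for all l in this interval, and f is concave on the interval [n/(r+1), 2n/(r+2)]. -/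
/-- The homogeneous polynomial inequality. -/
lemma quartic_aux (u p q : ℝ) (hu : 0 < u) (hp : u / 2 ≤ p) (hpq : p ≤ q) (hq : q ≤ u) :
    p ^ 2 * (u ^ 2 + u * q + q ^ 2) - 4 * p * q * u ^ 2 + q * u ^ 3 ≤ 0 := by
  have hq0 : 0 < q := by linarith
  have hS : 0 < u ^ 2 + u * q + q ^ 2 := by positivity
  rcases eq_or_lt_of_le (show u / 2 ≤ q by linarith) with h | h
  · have : p = q := by linarith
    subst this
    have : u = 2 * p := by linarith
    subst this
    nlinarith [pow_pos hq0 4]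
  · -- convexity in p between u/2 and q
    have h1 : q ^ 2 * (u ^ 2 + u * q + q ^ 2) - 4 * q * q * u ^ 2 + q * u ^ 3 ≤ 0 := by
      have e : q ^ 2 * (u ^ 2 + u * q + q ^ 2) - 4 * q * q * u ^ 2 + q * u ^ 3
        = -(q * ((u - q) * (q ^ 2 + 2 * q * u - u ^ 2))) := by ring
      have : 0 ≤ q ^ 2 + 2 * q * u - u ^ 2 := by nlinarith
      have : 0 ≤ q * ((u - q) * (q ^ 2 + 2 * q * u - u ^ 2)) :=
        mul_nonneg hq0.le (mul_nonneg (by linarith) this)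
      linarith
    have h2 : (u / 2) ^ 2 * (u ^ 2 + u * q + q ^ 2) - 4 * (u / 2) * q * u ^ 2 + q * u ^ 3 ≤ 0 := by
      have e : (u / 2) ^ 2 * (u ^ 2 + u * q + q ^ 2) - 4 * (u / 2) * q * u ^ 2 + q * u ^ 3
        = -(u ^ 2 / 4 * (3 * u * q - u ^ 2 - q ^ 2)) := by ring
      have : 0 ≤ 3 * u * q - u ^ 2 - q ^ 2 := by nlinarith
      have : 0 ≤ u ^ 2 / 4 * (3 * u * q - u ^ 2 - q ^ 2) := by positivity
      linarith
    have h3 : 0 ≤ (p - u / 2) * (q - p) := mul_nonneg (by linarith) (by linarith)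
    have hd : 0 < q - u / 2 := by linarith
    have a1 := mul_nonneg (show 0 ≤ p - u / 2 by linarith) (neg_nonneg.2 h1)
    have a2 := mul_nonneg (show 0 ≤ q - p by linarith) (neg_nonneg.2 h2)
    have a3 := mul_nonneg (mul_nonneg h3 hS.le) hd.le
    by_contra hc
    push Not at hc
    have a4 := mul_pos hd hc
    nlinarith

lemma g_aux (n r l : ℝ) (hr : 2 ≤ r) (hn : 2 * (r + 2) ≤ n)
    (h1 : n ≤ l * (r + 1)) (h2 : l * (r + 2) ≤ 2 * n) (hl : 0 < l) (A B C : ℝ)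
    (hA : A = (r + 1) * (r + 2)) (hB : B = 2 * n * (2 * r + 3) - 2) (hC : C = 4 * n ^ 2) :
    -A ^ 2 * l ^ 4 + 4 * A * C * l ^ 2 - 2 * B * C * l + C ^ 2 ≤ 0 := by
  have hn0 : 0 < n := by linarith
  have hK := quartic_aux (2 * n) (l * (r + 1)) (l * (r + 2)) (by linarith) (by linarith)
    (by nlinarith) h2
  have hm := mul_nonneg (sub_nonneg.2 h2) (neg_nonneg.2 hK)
  have hq : 0 < l * (r + 2) := by positivity
  have hx : 0 ≤ (n - 2 * (r + 2)) * (l ^ 2 * (8 * n ^ 2)) :=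
    mul_nonneg (by linarith) (by positivity)
  by_contra hc
  push Not at hc
  have := mul_pos hq hc
  subst hA hB hC
  nlinarith

theorem stmt_9 (n r : ℝ) (hr : 2 ≤ r) (hn : 2 * (r + 2) ≤ n) :
    (∀ l ∈ Set.Icc (n / (r + 1)) (2 * n / (r + 2)),
      (1 : ℝ) ≤ 1 + (2 * n - l * (r + 1)) * (2 * n - l * (r + 2)) / (2 * l)) ∧
    ConcaveOn ℝ (Set.Icc (n / (r + 1)) (2 * n / (r + 2)))
      (fun l => l +
        Real.logb 2 (1 + (2 * n - l * (r + 1)) * (2 * n - l * (r + 2)) / (2 * l))) := by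
  have hn0 : 0 < n := by linarith
  have hI : ∀ l ∈ Set.Icc (n / (r + 1)) (2 * n / (r + 2)),
      0 < l ∧ n ≤ l * (r + 1) ∧ l * (r + 2) ≤ 2 * n := by
    rintro l ⟨h1, h2⟩
    have : 0 < n / (r + 1) := by positivity
    exact ⟨by linarith, (div_le_iff₀ (by linarith)).1 h1, (le_div_iff₀ (by linarith)).1 h2⟩
  have hnn : ∀ l ∈ Set.Icc (n / (r + 1)) (2 * n / (r + 2)),
      0 ≤ (2 * n - l * (r + 1)) * (2 * n - l * (r + 2)) := by
    intro l hl
    obtain ⟨h0, h1, h2⟩ := hI l hl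
    exact mul_nonneg (by nlinarith) (by linarith)
  refine ⟨fun l hl => ?_, ?_⟩
  · have := div_nonneg (hnn l hl) (by linarith [(hI l hl).1] : 0 ≤ 2 * l)
    linarith
  obtain ⟨A, hA⟩ : ∃ A, A = (r + 1) * (r + 2) := ⟨_, rfl⟩
  obtain ⟨B, hB⟩ : ∃ B, B = 2 * n * (2 * r + 3) - 2 := ⟨_, rfl⟩
  obtain ⟨C, hC⟩ : ∃ C, C = 4 * n ^ 2 := ⟨_, rfl⟩
  have hP : ∀ l ∈ Set.Icc (n / (r + 1)) (2 * n / (r + 2)), 0 < A * l ^ 2 - B * l + C := by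
    intro l hl
    have := hnn l hl
    have := (hI l hl).1
    subst hA hB hC
    nlinarith
  have hL : 0 < Real.log 2 := Real.log_pos (by norm_num)
  have hmain : ConcaveOn ℝ (Set.Icc (n / (r + 1)) (2 * n / (r + 2)))
      (fun l => l + (Real.log (A * l ^ 2 - B * l + C) - Real.log (2 * l)) / Real.log 2) := by
    have hD : ∀ l : ℝ, HasDerivAt (fun l : ℝ => A * l ^ 2 - B * l + C) (2 * A * l - B) l := by
      intro l
      have := ((((hasDerivAt_id l).pow 2).const_mul A).sub
        ((hasDerivAt_id l).const_mul B)).add_const C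
      refine this.congr_deriv ?_
      simp; ring
    have hD2 : ∀ l : ℝ, HasDerivAt (fun l : ℝ => 2 * A * l - B) (2 * A) l := by
      intro l
      simpa using ((hasDerivAt_id l).const_mul (2 * A)).sub_const B
    have hd1 : ∀ l ∈ Set.Icc (n / (r + 1)) (2 * n / (r + 2)), HasDerivAt
        (fun l => l + (Real.log (A * l ^ 2 - B * l + C) - Real.log (2 * l)) / Real.log 2)
        (1 + ((2 * A * l - B) / (A * l ^ 2 - B * l + C) - l⁻¹) / Real.log 2) l := by
      intro l hl
      have h0 := (hI l hl).1
      have e2 := ((hasDerivAt_id l).const_mul 2).log (by simpa using h0.ne')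
      have := (hasDerivAt_id l).add ((((hD l).log (hP l hl).ne').sub e2).div_const (Real.log 2))
      refine this.congr_deriv ?_
      simp only [id]
      field_simp
    refine concaveOn_of_hasDerivWithinAt2_nonpos (convex_Icc _ _)
      (fun l hl => (hd1 l hl).continuousAt.continuousWithinAt)
      (fun l hl => (hd1 l (interior_subset hl)).hasDerivWithinAt)
      (f'' := fun l => ((2 * A * (A * l ^ 2 - B * l + C) - (2 * A * l - B) * (2 * A * l - B))
        / (A * l ^ 2 - B * l + C) ^ 2 - (-(l ^ 2)⁻¹)) / Real.log 2) ?_ ?_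
    · intro l hl
      have hl := interior_subset hl
      exact (((((hD2 l).div (hD l) (hP l hl).ne').sub
        (hasDerivAt_inv (hI l hl).1.ne')).div_const (Real.log 2)).const_add 1).hasDerivWithinAt
    · intro l hl
      have hl := interior_subset hl
      obtain ⟨h0, h1, h2⟩ := hI l hl
      have hp := hP l hl
      have hg := g_aux n r l hr hn h1 h2 h0 A B C hA hB hC
      apply div_nonpos_of_nonpos_of_nonneg _ hL.le
      have e : (2 * A * (A * l ^ 2 - B * l + C) - (2 * A * l - B) * (2 * A * l - B))
        / (A * l ^ 2 - B * l + C) ^ 2 - (-(l ^ 2)⁻¹) =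
        (-A ^ 2 * l ^ 4 + 4 * A * C * l ^ 2 - 2 * B * C * l + C ^ 2) /
          ((A * l ^ 2 - B * l + C) ^ 2 * l ^ 2) := by
        have := hp.ne'
        have := h0.ne'
        generalize hQ : A * l ^ 2 - B * l + C = Q at *
        field_simp
        subst hQ
        ring
      rw [e]
      exact div_nonpos_of_nonpos_of_nonneg hg (by positivity)
  refine hmain.congr ?_
  intro l hl
  have h0 := (hI l hl).1
  have hp := hP l hl
  simp only [Real.logb]
  rw [← Real.log_div hp.ne' (by positivity)]
  congr 3
  subst hA hB hC
  field_simp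
  ring
end
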